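/- arXiv:2104.07352 — 2 statements merged into one kernel-verified Lean document; each statement's English description precedes it below -/
import Mathlib

section
/- Let β, λ ∈ [0,1] and let S̃pv and S̃f be real-valued random variables on a probability space that are independent, with P(0 ≤ S̃pv ≤ 1) ≥ 1 − β and P(0 ≤ S̃f ≤ 1) = 1 − λ. Let E_n > 0, E_pv ≥ 0, E_f ≥ 0 and real numbers Smin ≤ Smax satisfy E_pv + E_f = E_n·(Smax − Smin). Define the random variable S = (E_pv/E_n)·S̃pv + (E_f/E_n)·S̃f + Smin. Then P(Smin ≤ S ≤ Smax) ≥ 1 − λmax, where λmax = λ + β − λ·β. -/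
open MeasureTheory ProbabilityTheory

/-- Proposition 1: if the per-unit PV-battery SoE stays in `[0,1]` with probability at
least `1 - β`, the per-unit PFR-battery SoE stays in `[0,1]` with probability exactly
`1 - λ`, the two are independent, and the capacities satisfy
`E_pv + E_f = E_n (Smax - Smin)`, then the total SoE
`S = (E_pv/E_n)·S̃pv + (E_f/E_n)·S̃f + Smin` stays in `[Smin, Smax]` with probability at
least `1 - λmax`, with `λmax = λ + β - λ·β`. -/
theorem dap_failure_rate
    {Ω : Type*} [MeasurableSpace Ω] (μ : Measure Ω) [IsProbabilityMeasure μ]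
    (Spv Sf : Ω → ℝ) (hIndep : IndepFun Spv Sf μ)
    (β lam : ℝ) (hβ : β ∈ Set.Icc (0:ℝ) 1) (hlam : lam ∈ Set.Icc (0:ℝ) 1)
    (hPpv : ENNReal.ofReal (1 - β) ≤ μ {ω | Spv ω ∈ Set.Icc (0:ℝ) 1})
    (hPf : μ {ω | Sf ω ∈ Set.Icc (0:ℝ) 1} = ENNReal.ofReal (1 - lam))
    (En Epv Ef Smin Smax : ℝ) (hEn : 0 < En) (hEpv : 0 ≤ Epv) (hEf : 0 ≤ Ef)
    (hSS : Smin ≤ Smax) (hsplit : Epv + Ef = En * (Smax - Smin))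
    (S : Ω → ℝ)
    (hS : ∀ ω, S ω = (Epv / En) * Spv ω + (Ef / En) * Sf ω + Smin) :
    ENNReal.ofReal (1 - (lam + β - lam * β)) ≤ μ {ω | Smin ≤ S ω ∧ S ω ≤ Smax} := by
  have hinter : μ (Spv ⁻¹' Set.Icc 0 1 ∩ Sf ⁻¹' Set.Icc 0 1) =
      μ (Spv ⁻¹' Set.Icc 0 1) * μ (Sf ⁻¹' Set.Icc 0 1) :=
    hIndep.measure_inter_preimage_eq_mul _ _ measurableSet_Icc measurableSet_Icc
  have hsub : Spv ⁻¹' Set.Icc 0 1 ∩ Sf ⁻¹' Set.Icc 0 1 ⊆ {ω | Smin ≤ S ω ∧ S ω ≤ Smax} := by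
    rintro ω ⟨⟨hp0, hp1⟩, ⟨hf0, hf1⟩⟩
    have ha : 0 ≤ Epv / En := div_nonneg hEpv hEn.le
    have hb : 0 ≤ Ef / En := div_nonneg hEf hEn.le
    have hab : Epv / En + Ef / En = Smax - Smin := by
      rw [← add_div, hsplit, mul_div_cancel_left₀ _ hEn.ne']
    have hp := mul_nonneg ha hp0
    have hf := mul_nonneg hb hf0
    have hp' := mul_le_of_le_one_right ha hp1
    have hf' := mul_le_of_le_one_right hb hf1
    rw [Set.mem_ofPred_eq, hS]
    constructor <;> linarith
  calc ENNReal.ofReal (1 - (lam + β - lam * β))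
      = ENNReal.ofReal (1 - β) * ENNReal.ofReal (1 - lam) := by
        rw [← ENNReal.ofReal_mul (sub_nonneg.2 hβ.2)]
        ring_nf
    _ ≤ μ (Spv ⁻¹' Set.Icc 0 1) * μ (Sf ⁻¹' Set.Icc 0 1) := mul_le_mul' hPpv hPf.ge
    _ = μ (Spv ⁻¹' Set.Icc 0 1 ∩ Sf ⁻¹' Set.Icc 0 1) := hinter.symm
    _ ≤ μ {ω | Smin ≤ S ω ∧ S ω ≤ Smax} := measure_mono hsub
end

section
/- Let N be a natural number, τ > 0, E_n > 0, E_pv > 0, E_f > 0, α a real number, and real numbers Smin, Smin_d with given sequences (Pm_k), (Ppv_k), (Wf_k) for k = 0,…,N−1 and an initial value S_0. Define sequences by S_{k+1} = S_k − τ(Pm_k − Ppv_k)/(3600·E_n) + α·Wf_k/E_n; S̃pv_{k+1} = S̃pv_k − τ(Pm_k − Ppv_k)/(3600·E_pv) with S̃pv_0 = E_n(S_0 − Smin_d)/E_pv; and S̃f_{k+1} = S̃f_k + α·Wf_k/E_f with S̃f_0 = E_n(Smin_d − Smin)/E_f. Set Spv_k = (E_pv/E_n)·S̃pv_k + Smin_d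 and Sf_k = (E_f/E_n)·S̃f_k + Smin. Then for all k = 0,…,N, S_k = Spv_k + Sf_k − Smin_d. -/
/-- Equation (21) of the paper: the battery state-of-energy trajectory decomposes as
`S_k = Spv_k + (Sf_k - Smin_d)`, where `Spv` and `Sf` are the rescaled per-unit
trajectories of the PV and PFR equivalent sub-batteries. -/
theorem soe_decomposition
    (N : ℕ) (τ En Epv Ef α Smin Smind : ℝ)
    (hτ : 0 < τ) (hEn : 0 < En) (hEpv : 0 < Epv) (hEf : 0 < Ef)
    (Pm Ppv Wf : ℕ → ℝ) (S0 : ℝ)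
    (S Spvt Sft : ℕ → ℝ)
    (hS0 : S 0 = S0)
    (hS : ∀ k < N, S (k + 1) =
      S k - τ * (Pm k - Ppv k) / (3600 * En) + α * Wf k / En)
    (hSpvt0 : Spvt 0 = En * (S0 - Smind) / Epv)
    (hSpvt : ∀ k < N, Spvt (k + 1) = Spvt k - τ * (Pm k - Ppv k) / (3600 * Epv))
    (hSft0 : Sft 0 = En * (Smind - Smin) / Ef)
    (hSft : ∀ k < N, Sft (k + 1) = Sft k + α * Wf k / Ef)
    (Spv Sf : ℕ → ℝ)
    (hSpv : ∀ k, Spv k = (Epv / En) * Spvt k + Smind)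
    (hSf : ∀ k, Sf k = (Ef / En) * Sft k + Smin) :
    ∀ k ≤ N, S k = Spv k + (Sf k - Smind) := by
  intro k
  induction k with
  | zero =>
    intro _
    rw [hSpv, hSf, hS0, hSpvt0, hSft0]
    field_simp
    ring
  | succ k ih =>
    intro hk
    have h := ih (Nat.le_of_succ_le hk)
    rw [hSpv, hSf] at h
    rw [hSpv, hSf, hS k hk, hSpvt k hk, hSft k hk, h]
    field_simp
    ring
end
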